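/- Let N ≥ 1, p > 0, and let ω₁, ω₂ : ℝ^N → ℝ be smooth positive functions. Suppose there exists t with 0 < t < p + √(p(p+1)) such that I_M(R) → 0 and J_M(R) → 0 as R → ∞, where I_M(R) = R^{-2(p+2t+1)/(p+1)} ∫_{R<|x|<2R} (ω₁^{p+2t+1}/ω₂^{2t})^{1/(p+1)} dx and J_M(R) = R^{-(p+2t+1)/(p+1)} ∫_{R<|x|<2R} (|∇ω₁|^{p+2t+1}/ω₂^{2t})^{1/(p+1)} dx. Then there is no positive stable super-solution of the equation −div(ω₁ ∇u) = −ω₂ u^{−p} in ℝ^N. -/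

import Mathlib

open MeasureTheory Filter Real
open scoped RealInnerProductSpace

noncomputable def vdiv {N : ℕ} (V : EuclideanSpace ℝ (Fin N) → EuclideanSpace ℝ (Fin N))
    (x : EuclideanSpace ℝ (Fin N)) : ℝ :=
  LinearMap.trace ℝ (EuclideanSpace ℝ (Fin N)) (fderiv ℝ V x).toLinearMap

def annulus (N : ℕ) (R : ℝ) : Set (EuclideanSpace ℝ (Fin N)) :=
  {x | R < ‖x‖ ∧ ‖x‖ < 2 * R}

open scoped Gradient

section Gradient

variable {F : Type*} [NormedAddCommGroup F] [InnerProductSpace ℝ F] [CompleteSpace F]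

theorem HasDerivAt.comp_hasGradientAt {h : ℝ → ℝ} {h' : ℝ} {f : F → ℝ} {f' x : F}
    (hh : HasDerivAt h h' (f x)) (hf : HasGradientAt f f' x) :
    HasGradientAt (fun y => h (f y)) (h' • f') x := by
  rw [hasGradientAt_iff_hasFDerivAt] at hf ⊢
  simpa using! hh.comp_hasFDerivAt x hf

theorem HasGradientAt.fun_mul {f g : F → ℝ} {f' g' x : F}
    (hf : HasGradientAt f f' x) (hg : HasGradientAt g g' x) :
    HasGradientAt (fun y => f y * g y) (f x • g' + g x • f') x := by
  rw [hasGradientAt_iff_hasFDerivAt] at hf hg ⊢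
  simpa using! hf.mul hg

theorem gradient_rpow_mul {u φ : F → ℝ} {x : F} (hu : DifferentiableAt ℝ u x)
    (hφ : DifferentiableAt ℝ φ x) (hpos : 0 < u x) (s : ℝ) :
    ∇ (fun y => u y ^ s * φ y) x = u x ^ s • ∇ φ x + φ x • (s * u x ^ (s - 1)) • ∇ u x :=
  (((Real.hasDerivAt_rpow_const (Or.inl hpos.ne')).comp_hasGradientAt hu.hasGradientAt).fun_mul
    hφ.hasGradientAt).gradient

theorem gradient_pow {φ : F → ℝ} {x : F} (hφ : DifferentiableAt ℝ φ x) (m : ℕ) :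
    ∇ (fun y => φ y ^ m) x = (m * φ x ^ (m - 1)) • ∇ φ x :=
  ((hasDerivAt_pow m (φ x)).comp_hasGradientAt hφ.hasGradientAt).gradient

theorem ContDiff.gradient {f : F → ℝ} {m n : WithTop ℕ∞} (hf : ContDiff ℝ n f) (hmn : m + 1 ≤ n) :
    ContDiff ℝ m (∇ f) :=
  (InnerProductSpace.toDual ℝ F).symm.contDiff.comp (hf.fderiv_right hmn)

theorem norm_gradient (f : F → ℝ) (x : F) : ‖∇ f x‖ = ‖fderiv ℝ f x‖ :=
  (InnerProductSpace.toDual ℝ F).symm.norm_map _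

theorem gradient_eq_zero_of_notMem_tsupport {f : F → ℝ} {x : F} (hx : x ∉ tsupport f) :
    ∇ f x = 0 := by
  rw [← norm_eq_zero, norm_gradient, norm_eq_zero]
  exact image_eq_zero_of_notMem_tsupport fun h => hx (tsupport_fderiv_subset ℝ h)

end Gradient

theorem integrable_of_eq_zero_of_notMem {E : Type*} [TopologicalSpace E] [MeasurableSpace E]
    [BorelSpace E] [R1Space E] {μ : Measure E}
    [IsFiniteMeasureOnCompacts μ] {F φ : E → ℝ} (hF : Continuous F)
    (hφ : HasCompactSupport φ) (h : ∀ x ∉ tsupport φ, F x = 0) : Integrable F μ :=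
  hF.integrable_of_hasCompactSupport (HasCompactSupport.intro hφ h)

section Euclidean

variable {N : ℕ}

local notation "E" => EuclideanSpace ℝ (Fin N)

theorem vdiv_eq_sum (V : E → E) (x : E) :
    vdiv V x = ∑ i, ⟪EuclideanSpace.basisFun (Fin N) ℝ i,
      fderiv ℝ V x (EuclideanSpace.basisFun (Fin N) ℝ i)⟫ :=
  LinearMap.trace_eq_sum_inner _ _

theorem continuous_vdiv {V : E → E} (hV : ContDiff ℝ 1 V) : Continuous (vdiv V) := by
  have h := hV.continuous_fderiv one_ne_zero
  simp_rw [funext (vdiv_eq_sum V)]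
  fun_prop

theorem integral_vdiv_mul {V : E → E} {g : E → ℝ} (hV : ContDiff ℝ 1 V) (hg : ContDiff ℝ 1 g)
    (hgc : HasCompactSupport g) :
    ∫ x, vdiv V x * g x = -∫ x, ⟪V x, ∇ g x⟫ := by
  set b := EuclideanSpace.basisFun (Fin N) ℝ
  have hVd := hV.differentiable one_ne_zero
  have hgd := hg.differentiable one_ne_zero
  have hV' := hV.continuous_fderiv one_ne_zero
  have hg' := hg.continuous_fderiv one_ne_zero
  have hVc := hV.continuous
  have hgc' := hg.continuous
  have hgz : ∀ x ∉ tsupport g, g x = 0 := fun x hx => image_eq_zero_of_notMem_tsupport hx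
  have hfz : ∀ x ∉ tsupport g, fderiv ℝ g x = 0 := fun x hx =>
    image_eq_zero_of_notMem_tsupport fun h => hx (tsupport_fderiv_subset ℝ h)
  have hfd : ∀ i x, fderiv ℝ (fun y => ⟪b i, V y⟫) x (b i) = ⟪b i, fderiv ℝ V x (b i)⟫ := by
    intro i x
    rw [fderiv_inner_apply ℝ (differentiableAt_const _) (hVd x)]
    simp
  have hI1 : ∀ i, Integrable (fun x => ⟪b i, fderiv ℝ V x (b i)⟫ * g x) := fun i =>
    integrable_of_eq_zero_of_notMem (by fun_prop) hgc fun x hx => by simp [hgz x hx]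
  have hI2 : ∀ i, Integrable (fun x => ⟪b i, V x⟫ * fderiv ℝ g x (b i)) := fun i =>
    integrable_of_eq_zero_of_notMem (by fun_prop) hgc fun x hx => by simp [hfz x hx]
  have hI3 : ∀ i, Integrable (fun x => ⟪b i, V x⟫ * g x) := fun i =>
    integrable_of_eq_zero_of_notMem (by fun_prop) hgc fun x hx => by simp [hgz x hx]
  have key : ∀ i, ∫ x, ⟪b i, V x⟫ * fderiv ℝ g x (b i) =
      -∫ x, ⟪b i, fderiv ℝ V x (b i)⟫ * g x := by
    intro i
    have := integral_mul_fderiv_eq_neg_fderiv_mul_of_integrable (μ := volume)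
      (f := fun x => ⟪b i, V x⟫) (g := g) (v := b i)
      (by simpa only [hfd] using hI1 i) (hI2 i) (hI3 i)
      (fun x _ => (differentiableAt_const _).inner ℝ (hVd x)) (fun x _ => hgd x)
    simpa only [hfd] using this
  have hinner : ∀ x, ⟪V x, ∇ g x⟫ = ∑ i, ⟪b i, V x⟫ * fderiv ℝ g x (b i) := by
    intro x
    rw [← b.sum_inner_mul_inner]
    refine Finset.sum_congr rfl fun i _ => ?_
    rw [real_inner_comm, inner_gradient_right]
    simp
  simp_rw [vdiv_eq_sum, hinner, Finset.sum_mul]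
  rw [integral_finsetSum _ fun i _ => hI1 i, integral_finsetSum _ fun i _ => hI2 i,
    ← Finset.sum_neg_distrib]
  exact Finset.sum_congr rfl fun i _ => by rw [key i, neg_neg]

theorem exists_cutoff (N : ℕ) : ∃ c : ℝ, 0 ≤ c ∧ ∀ R : ℝ, 0 < R →
    ∃ η : EuclideanSpace ℝ (Fin N) → ℝ, ContDiff ℝ 2 η ∧ HasCompactSupport η ∧
      (∀ x, 0 ≤ η x) ∧ (∀ x, η x ≤ 1) ∧ (∀ x, ‖x‖ ≤ R → η x = 1) ∧
      (∀ x ∉ annulus N R, ∇ η x = 0) ∧ ∀ x, ‖∇ η x‖ ≤ c / R := by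
  let f : ContDiffBump (0 : EuclideanSpace ℝ (Fin N)) := ⟨1, 2, one_pos, one_lt_two⟩
  have hf : ContDiff ℝ 2 f := f.contDiff
  obtain ⟨c, hc⟩ := (f.hasCompactSupport.fderiv ℝ).exists_bound_of_continuous
    (hf.continuous_fderiv two_ne_zero)
  refine ⟨c, (norm_nonneg _).trans (hc 0), fun R hR => ?_⟩
  have h1 : ∀ x : EuclideanSpace ℝ (Fin N), ‖x‖ ≤ R → f (R⁻¹ • x) = 1 := by
    intro x hx
    apply f.one_of_mem_closedBall
    rw [mem_closedBall_zero_iff, norm_smul, norm_inv, Real.norm_of_nonneg hR.le]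
    exact (inv_mul_le_one₀ hR).2 hx
  have h0 : ∀ x : EuclideanSpace ℝ (Fin N), 2 * R ≤ ‖x‖ → f (R⁻¹ • x) = 0 := by
    intro x hx
    apply f.zero_of_le_dist
    rw [dist_zero_right, norm_smul, norm_inv, Real.norm_of_nonneg hR.le]
    exact (le_inv_mul_iff₀ hR).2 (by linarith)
  refine ⟨fun x => f (R⁻¹ • x), by fun_prop, ?_, fun x => f.nonneg, fun x => f.le_one, h1, ?_, ?_⟩
  · refine HasCompactSupport.intro (isCompact_closedBall 0 (2 * R)) fun x hx => h0 x ?_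
    rw [mem_closedBall_zero_iff, not_le] at hx
    exact hx.le
  · intro x hx
    rw [← norm_eq_zero, norm_gradient, norm_eq_zero]
    rcases le_or_gt ‖x‖ R with h | h
    · exact IsLocalMax.fderiv_eq_zero (Eventually.of_forall fun y =>
        f.le_one.trans_eq (h1 x h).symm)
    · have h2 : 2 * R ≤ ‖x‖ := by
        by_contra h3
        exact hx ⟨h, not_le.1 h3⟩
      exact IsLocalMin.fderiv_eq_zero (Eventually.of_forall fun y =>
        (h0 x h2).trans_le f.nonneg)
  · intro x
    rw [norm_gradient, fderiv_comp_smul, norm_smul, norm_inv, Real.norm_of_nonneg hR.le,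
      inv_mul_eq_div]
    gcongr
    exact hc _

theorem exists_absorption_const {p t : ℝ} (hp : 0 < p) (ht : 0 < t)
    (hpt : t ^ 2 < p * (2 * t + 1)) : ∃ K : ℝ, 0 < K ∧ ∀ A B C X : ℝ, 0 ≤ C →
      p * A ≤ t ^ 2 * B - 2 * t * X + C → (2 * t + 1) * B ≤ A + 2 * X →
      (∀ ε > 0, 2 * |X| ≤ ε * B + ε⁻¹ * C) → A ≤ K * C := by
  set d := p * (2 * t + 1) - t ^ 2 with hd
  have hd0 : 0 < d := sub_pos.2 hpt
  obtain ⟨ε, hε, hεt, hεd⟩ : ∃ ε : ℝ, 0 < ε ∧ ε ≤ t ∧ ε * (p + t) ≤ d / 2 := by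
    refine ⟨min t (d / 2 / (p + t)), by positivity, min_le_left _ _, ?_⟩
    rw [← le_div_iff₀ (by positivity)]
    exact min_le_right _ _
  set L := (t ^ 2 + t * ε) * ε⁻¹ + (2 * t + 1 - ε) * (1 + t * ε⁻¹) with hL
  have hL0 : 0 < L := by
    have : 0 < 2 * t + 1 - ε := by linarith
    positivity
  refine ⟨L / (d / 2), by positivity, fun A B C X hC h1 h2 h3 => ?_⟩
  have hX := h3 ε hε
  have hX1 := le_abs_self X
  have hX2 := neg_abs_le X
  have e1 : (2 * t + 1 - ε) * B ≤ A + ε⁻¹ * C := by linarith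
  have e2 : p * A ≤ (t ^ 2 + t * ε) * B + (1 + t * ε⁻¹) * C := by
    nlinarith [mul_le_mul_of_nonneg_left hX ht.le, mul_le_mul_of_nonneg_left hX2 ht.le]
  have e3 := mul_le_mul_of_nonneg_left e1 (by positivity : 0 ≤ t ^ 2 + t * ε)
  have e4 := mul_le_mul_of_nonneg_left e2 (by linarith : 0 ≤ 2 * t + 1 - ε)
  have e5 : (d - ε * (p + t)) * A ≤ L * C := by
    rw [hL, hd]; linarith
  rw [div_mul_eq_mul_div, le_div_iff₀ (by positivity)]
  rcases le_or_gt A 0 with hA | hA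
  · have : 0 ≤ L * C := by positivity
    nlinarith
  · nlinarith

theorem weighted_young {θ δ m : ℝ} {n : ℕ} (hθ : 0 < θ) (hθ1 : θ < 1) (hδ : 0 < δ)
    (hn : 1 ≤ (n : ℝ) * (1 - θ)) {W V y k : ℝ} (hW : 0 ≤ W) (hV : 0 ≤ V) (hy : 0 ≤ y) (hy1 : y ≤ 1)
    (hk : 0 ≤ k) :
    W ^ (1 - θ) * V ^ θ * (m * y ^ (n - 1)) ^ 2 * k ^ 2 ≤
      δ * (V * (y ^ n) ^ 2) + (m ^ 2 * δ ^ (-θ)) ^ (1 - θ)⁻¹ * k ^ (2 / (1 - θ)) * W := by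
  have h1θ : 0 < 1 - θ := sub_pos.2 hθ1
  have hn0 : n ≠ 0 := by
    rintro rfl
    simp at hn
    linarith
  have hpow : (y ^ (n - 1)) ^ 2 ≤ ((y ^ n) ^ 2) ^ θ := by
    rcases hy.eq_or_lt with rfl | hy0
    · rcases Nat.lt_or_ge 1 n with h | h
      · rw [zero_pow (by omega), zero_pow two_ne_zero]
        positivity
      · have : n = 1 := by omega
        subst this
        norm_num at hn
        linarith
    · have hL : (y ^ (n - 1)) ^ 2 = y ^ (2 * ((n : ℝ) - 1)) := by
        rw [← pow_mul, ← Real.rpow_natCast]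
        congr 1
        push_cast [Nat.one_le_iff_ne_zero.2 hn0]
        ring
      have hR : ((y ^ n) ^ 2) ^ θ = y ^ (2 * (n : ℝ) * θ) := by
        rw [← pow_mul, ← Real.rpow_natCast, ← Real.rpow_mul hy]
        congr 1
        push_cast
        ring
      rw [hL, hR]
      exact Real.rpow_le_rpow_of_exponent_ge hy0 hy1 (by linarith)
  have hyoung := Real.geom_mean_le_arith_mean2_weighted hθ.le h1θ.le
    (by positivity : 0 ≤ δ * (V * (y ^ n) ^ 2))
    (by positivity : 0 ≤ (m ^ 2 * δ ^ (-θ)) ^ (1 - θ)⁻¹ * k ^ (2 / (1 - θ)) * W) (by ring)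
  have hE : (δ * (V * (y ^ n) ^ 2)) ^ θ *
      ((m ^ 2 * δ ^ (-θ)) ^ (1 - θ)⁻¹ * k ^ (2 / (1 - θ)) * W) ^ (1 - θ) =
      W ^ (1 - θ) * V ^ θ * m ^ 2 * ((y ^ n) ^ 2) ^ θ * k ^ 2 := by
    rw [Real.mul_rpow hδ.le (by positivity), Real.mul_rpow hV (by positivity),
      Real.mul_rpow (by positivity) hW, Real.mul_rpow (by positivity) (by positivity),
      Real.rpow_inv_rpow (by positivity) h1θ.ne', ← Real.rpow_mul hk,
      div_mul_cancel₀ _ h1θ.ne', Real.rpow_two, Real.rpow_neg hδ.le]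
    have := (Real.rpow_pos_of_pos hδ θ).ne'
    field_simp
  have hb1 : θ * (δ * (V * (y ^ n) ^ 2)) ≤ δ * (V * (y ^ n) ^ 2) :=
    mul_le_of_le_one_left (by positivity) hθ1.le
  have hb2 : (1 - θ) * ((m ^ 2 * δ ^ (-θ)) ^ (1 - θ)⁻¹ * k ^ (2 / (1 - θ)) * W) ≤
      (m ^ 2 * δ ^ (-θ)) ^ (1 - θ)⁻¹ * k ^ (2 / (1 - θ)) * W :=
    mul_le_of_le_one_left (by positivity) (by linarith)
  calc W ^ (1 - θ) * V ^ θ * (m * y ^ (n - 1)) ^ 2 * k ^ 2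
      = W ^ (1 - θ) * V ^ θ * m ^ 2 * (y ^ (n - 1)) ^ 2 * k ^ 2 := by ring
    _ ≤ W ^ (1 - θ) * V ^ θ * m ^ 2 * ((y ^ n) ^ 2) ^ θ * k ^ 2 := by gcongr
    _ ≤ _ := by rw [← hE]; linarith

theorem stable_energy_estimate {p t : ℝ} (hp : 0 < p) (ht : 0 < t)
    (hpt : t ^ 2 < p * (2 * t + 1)) : ∃ K : ℝ, 0 < K ∧ ∀ {ω₁ ω₂ u φ : E → ℝ},
      ContDiff ℝ 1 ω₁ → Continuous ω₂ → (∀ x, 0 < ω₁ x) → ContDiff ℝ 2 u → (∀ x, 0 < u x) →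
      (∀ x, -(ω₂ x * u x ^ (-p)) ≤ -vdiv (fun y => ω₁ y • ∇ u y) x) →
      (∀ ψ : E → ℝ, ContDiff ℝ 2 ψ → HasCompactSupport ψ →
        ∫ x, p * ω₂ x * u x ^ (-p - 1) * ψ x ^ 2 ≤ ∫ x, ω₁ x * ‖∇ ψ x‖ ^ 2) →
      ContDiff ℝ 2 φ → HasCompactSupport φ →
      ∫ x, ω₂ x * u x ^ (-(p + 2 * t + 1)) * φ x ^ 2 ≤
        K * ∫ x, ω₁ x * u x ^ (-(2 * t)) * ‖∇ φ x‖ ^ 2 := by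
  obtain ⟨K, hK, hKall⟩ := exists_absorption_const hp ht hpt
  refine ⟨K, hK, fun {ω₁ ω₂ u φ} hω₁ hω₂ hω₁pos hu hupos hsup hstab hφ hφc => ?_⟩
  have hu0 : ∀ x, u x ≠ 0 := fun x => (hupos x).ne'
  have hud := hu.differentiable two_ne_zero
  have hφd := hφ.differentiable two_ne_zero
  have hu' : ContDiff ℝ 1 (∇ u) := hu.gradient (by norm_num)
  have hφ' : ContDiff ℝ 1 (∇ φ) := hφ.gradient (by norm_num)
  have hcu := hu'.continuous
  have hcφ := hφ'.continuous
  have hcω₁ := hω₁.continuous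
  have hφ0 := hφ.continuous
  have hcr : ∀ s : ℝ, Continuous fun x => u x ^ s := fun s =>
    hu.continuous.rpow_const fun x => Or.inl (hu0 x)
  have hzero : ∀ x ∉ tsupport φ, φ x = 0 := fun x hx => image_eq_zero_of_notMem_tsupport hx
  have hzero' : ∀ x ∉ tsupport φ, ∇ φ x = 0 := fun x hx =>
    gradient_eq_zero_of_notMem_tsupport hx
  set fA := fun x => ω₂ x * u x ^ (-(p + 2 * t + 1)) * φ x ^ 2 with hfA
  set fB := fun x => ω₁ x * u x ^ (-(2 * t + 2)) * φ x ^ 2 * ‖∇ u x‖ ^ 2 with hfB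
  set fC := fun x => ω₁ x * u x ^ (-(2 * t)) * ‖∇ φ x‖ ^ 2 with hfC
  set fX := fun x => ω₁ x * u x ^ (-(2 * t + 1)) * φ x * ⟪∇ u x, ∇ φ x⟫ with hfX
  have hA : Integrable fA := integrable_of_eq_zero_of_notMem
    ((hω₂.mul (hcr _)).mul (hφ0.pow 2)) hφc fun x hx => by simp [hfA, hzero x hx]
  have hB : Integrable fB := integrable_of_eq_zero_of_notMem
    (((hcω₁.mul (hcr _)).mul (hφ0.pow 2)).mul (hcu.norm.pow 2)) hφc
    fun x hx => by simp [hfB, hzero x hx]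
  have hC : Integrable fC := integrable_of_eq_zero_of_notMem
    ((hcω₁.mul (hcr _)).mul (hcφ.norm.pow 2)) hφc fun x hx => by simp [hfC, hzero' x hx]
  have hX : Integrable fX := integrable_of_eq_zero_of_notMem
    (((hcω₁.mul (hcr _)).mul hφ0).mul (hcu.inner hcφ)) hφc fun x hx => by simp [hfX, hzero x hx]
  have hr : ∀ (x : E) (a b c : ℝ), c = a + b →
      u x ^ c = u x ^ a * u x ^ b := fun x a b c h => by
    rw [h, Real.rpow_add (hupos x)]
  refine hKall (∫ x, fA x) (∫ x, fB x) (∫ x, fC x) (∫ x, fX x)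
    (integral_nonneg fun x => by
      have := hω₁pos x
      have := hupos x
      positivity) ?_ ?_ ?_
  · have h := hstab (fun x => u x ^ (-t) * φ x) ((hu.rpow_const_of_ne hu0).mul hφ)
      hφc.mul_left
    have hl : ∀ x, p * ω₂ x * u x ^ (-p - 1) * (u x ^ (-t) * φ x) ^ 2 = p * fA x := by
      intro x
      simp only [hfA]
      rw [hr x (-p - 1) (-t + -t) (-(p + 2 * t + 1)) (by ring), hr x (-t) (-t) (-t + -t) rfl]
      ring
    have hrr : ∀ x, ω₁ x * ‖∇ (fun x => u x ^ (-t) * φ x) x‖ ^ 2 =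
        t ^ 2 * fB x - 2 * t * fX x + fC x := by
      intro x
      rw [gradient_rpow_mul (hud x) (hφd x) (hupos x), norm_add_sq_real]
      simp only [norm_smul, inner_smul_left, inner_smul_right, mul_pow, Real.norm_eq_abs, sq_abs,
        hfB, hfX, hfC, real_inner_comm (∇ u x) (∇ φ x)]
      rw [hr x (-t - 1) (-t - 1) (-(2 * t + 2)) (by ring), hr x (-t) (-t) (-(2 * t)) (by ring),
        hr x (-t) (-t - 1) (-(2 * t + 1)) (by ring)]
      simp
      ring
    simp_rw [hl, hrr] at h
    rwa [integral_const_mul, integral_add (f := fun x => t ^ 2 * fB x - 2 * t * fX x)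
        ((hB.const_mul _).sub (hX.const_mul _)) hC,
      integral_sub (hB.const_mul _) (hX.const_mul _), integral_const_mul, integral_const_mul] at h
  · set V : E → E := fun y => ω₁ y • ∇ u y with hV
    set g := fun x => u x ^ (-(2 * t + 1)) * φ x ^ 2 with hg
    have hVc : ContDiff ℝ 1 V := hω₁.smul hu'
    have hgC : ContDiff ℝ 2 g := (hu.rpow_const_of_ne hu0).mul (hφ.pow 2)
    have hgc : HasCompactSupport g := HasCompactSupport.intro hφc fun x hx => by
      simp [hg, hzero x hx]
    have hgn : ∀ x, 0 ≤ g x := fun x => by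
      have := hupos x
      positivity
    have hdiv := integral_vdiv_mul hVc (hgC.of_le one_le_two) hgc
    have hint : Integrable fun x => vdiv V x * g x :=
      integrable_of_eq_zero_of_notMem ((continuous_vdiv hVc).mul hgC.continuous) hφc
        fun x hx => by simp [hg, hzero x hx]
    have hle : ∫ x, vdiv V x * g x ≤ ∫ x, fA x := by
      refine integral_mono hint hA fun x => ?_
      calc vdiv V x * g x ≤ ω₂ x * u x ^ (-p) * g x :=
            mul_le_mul_of_nonneg_right (by linarith [hsup x]) (hgn x)
        _ = fA x := by
            simp only [hfA, hg]
            rw [hr x (-p) (-(2 * t + 1)) (-(p + 2 * t + 1)) (by ring)]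
            ring
    have hin : ∀ x, ⟪V x, ∇ g x⟫ = 2 * fX x - (2 * t + 1) * fB x := by
      intro x
      rw [hg, gradient_rpow_mul (φ := fun y => φ y ^ 2) (hud x) ((hφd x).pow 2) (hupos x),
        gradient_pow (hφd x)]
      simp only [hV, hfB, hfX, inner_add_right, inner_smul_left, inner_smul_right,
        real_inner_self_eq_norm_sq]
      rw [show -(2 * t + 1) - 1 = -(2 * t + 2) by ring]
      simp
      ring
    simp_rw [hin] at hdiv
    rw [integral_sub (hX.const_mul _) (hB.const_mul _), integral_const_mul,
      integral_const_mul] at hdiv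
    linarith
  · intro ε hε
    have hpt' : ∀ x, 2 * |fX x| ≤ ε * fB x + ε⁻¹ * fC x := by
      intro x
      have h1 := abs_real_inner_le_norm (∇ u x) (∇ φ x)
      set a := u x ^ (-(t + 1)) * |φ x| * ‖∇ u x‖ with ha
      set b := u x ^ (-t) * ‖∇ φ x‖ with hb
      have hω := hω₁pos x
      have hux := hupos x
      have eB : fB x = ω₁ x * a ^ 2 := by
        simp only [hfB, ha, mul_pow, sq_abs]
        rw [hr x (-(t + 1)) (-(t + 1)) (-(2 * t + 2)) (by ring)]
        ring
      have eC : fC x = ω₁ x * b ^ 2 := by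
        simp only [hfC, hb, mul_pow]
        rw [hr x (-t) (-t) (-(2 * t)) (by ring)]
        ring
      have eX : |fX x| ≤ ω₁ x * (a * b) := by
        simp only [hfX, abs_mul, abs_of_pos hω, abs_of_pos (Real.rpow_pos_of_pos hux _)]
        calc _ ≤ ω₁ x * u x ^ (-(2 * t + 1)) * |φ x| * (‖∇ u x‖ * ‖∇ φ x‖) := by gcongr
          _ = _ := by
            rw [ha, hb, hr x (-(t + 1)) (-t) (-(2 * t + 1)) (by ring)]
            ring
      have hab : 2 * (a * b) ≤ ε * a ^ 2 + ε⁻¹ * b ^ 2 := by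
        have h2 : 0 ≤ ε⁻¹ * (ε * a - b) ^ 2 := by positivity
        have h3 : ε⁻¹ * (ε * a - b) ^ 2 = ε * a ^ 2 - 2 * (a * b) + ε⁻¹ * b ^ 2 := by
          field_simp
          ring
        linarith
      rw [eB, eC]
      nlinarith [mul_le_mul_of_nonneg_left hab hω.le]
    calc 2 * |∫ x, fX x| ≤ 2 * ∫ x, |fX x| := by
          gcongr
          exact abs_integral_le_integral_abs
      _ = ∫ x, 2 * |fX x| := (integral_const_mul _ _).symm
      _ ≤ ∫ x, (ε * fB x + ε⁻¹ * fC x) :=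
          integral_mono (hX.abs.const_mul _) ((hB.const_mul _).add (hC.const_mul _)) hpt'
      _ = _ := by
          rw [integral_add (hB.const_mul _) (hC.const_mul _), integral_const_mul,
            integral_const_mul]

theorem measurableSet_annulus (N : ℕ) (R : ℝ) : MeasurableSet (annulus N R) :=
  (measurableSet_lt measurable_const measurable_norm).inter
    (measurableSet_lt measurable_norm measurable_const)

theorem integrableOn_annulus {W : E → ℝ} (hW : Continuous W) (R : ℝ) :
    IntegrableOn W (annulus N R) :=
  (hW.continuousOn.integrableOn_compact (isCompact_closedBall 0 (2 * R))).mono_set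
    fun _ hx => mem_closedBall_zero_iff.2 hx.2.le

theorem setIntegral_ball_pos {F : E → ℝ} (hF : ∀ x, 0 < F x) (hc : Continuous F) :
    0 < ∫ x in Metric.ball (0 : E) 1, F x := by
  have hint : IntegrableOn F (Metric.ball (0 : E) 1) :=
    (hc.continuousOn.integrableOn_compact (isCompact_closedBall 0 1)).mono_set
      Metric.ball_subset_closedBall
  rw [setIntegral_pos_iff_support_of_nonneg_ae (Eventually.of_forall fun x => (hF x).le) hint]
  have : Function.support F = Set.univ := Set.eq_univ_of_forall fun x => (hF x).ne'
  rw [this, Set.univ_inter]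
  exact Metric.measure_ball_pos _ _ one_pos

theorem exists_forall_energy_le {p t : ℝ} (hp : 0 < p) (ht : 0 < t)
    (hpt : t ^ 2 < p * (2 * t + 1)) {ω₁ ω₂ u : E → ℝ}
    (hω₁ : ContDiff ℝ 1 ω₁) (hω₂ : Continuous ω₂) (hω₁pos : ∀ x, 0 < ω₁ x)
    (hω₂pos : ∀ x, 0 < ω₂ x) (hu : ContDiff ℝ 2 u) (hupos : ∀ x, 0 < u x)
    (hsup : ∀ x, -(ω₂ x * u x ^ (-p)) ≤ -vdiv (fun y => ω₁ y • ∇ u y) x)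
    (hstab : ∀ ψ : E → ℝ, ContDiff ℝ 2 ψ → HasCompactSupport ψ →
      ∫ x, p * ω₂ x * u x ^ (-p - 1) * ψ x ^ 2 ≤ ∫ x, ω₁ x * ‖∇ ψ x‖ ^ 2) :
    ∃ D : ℝ, ∀ R : ℝ, 1 ≤ R →
      ∫ x in Metric.ball (0 : E) 1, ω₂ x * u x ^ (-(p + 2 * t + 1)) ≤
        D * (R ^ (-2 * (p + 2 * t + 1) / (p + 1)) *
          ∫ x in annulus N R, (ω₁ x ^ (p + 2 * t + 1) / ω₂ x ^ (2 * t)) ^ (1 / (p + 1))) := by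
  obtain ⟨K, hK, hen⟩ := stable_energy_estimate (N := N) hp ht hpt
  obtain ⟨c, hc, hcut⟩ := exists_cutoff N
  set q := p + 2 * t + 1 with hq
  have hq0 : 0 < q := by positivity
  set θ := 2 * t / q with hθ
  have hθ0 : 0 < θ := by positivity
  have h1θ : 1 - θ = (p + 1) / q := by
    rw [hθ, hq]
    field_simp
    ring
  have hθ1 : θ < 1 := by
    have : 0 < 1 - θ := by
      rw [h1θ]
      positivity
    linarith
  obtain ⟨n, hn⟩ := exists_nat_ge (1 - θ)⁻¹
  have hn' : 1 ≤ (n : ℝ) * (1 - θ) := (inv_le_iff_one_le_mul₀ (sub_pos.2 hθ1)).1 hn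
  have hn0 : n ≠ 0 := by
    rintro rfl
    norm_num at hn'
  set δ := (2 * K)⁻¹ with hδ
  have hδ0 : 0 < δ := by positivity
  set M := ((n : ℝ) ^ 2 * δ ^ (-θ)) ^ (1 - θ)⁻¹ with hM
  set W := fun x => (ω₁ x ^ q / ω₂ x ^ (2 * t)) ^ (1 / (p + 1)) with hWdef
  set V := fun x => ω₂ x * u x ^ (-q) with hVdef
  have hWc : Continuous W :=
    ((hω₁.continuous.rpow_const fun x => Or.inl (hω₁pos x).ne').div₀
      (hω₂.rpow_const fun x => Or.inl (hω₂pos x).ne')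
      fun x => (Real.rpow_pos_of_pos (hω₂pos x) _).ne').rpow_const fun x => Or.inr (by positivity)
  have hVc : Continuous V :=
    hω₂.mul (hu.continuous.rpow_const fun x => Or.inl (hupos x).ne')
  have hWpos : ∀ x, 0 < W x := fun x => by
    have := hω₁pos x
    have := hω₂pos x
    positivity
  have hVpos : ∀ x, 0 < V x := fun x => by
    have := hω₂pos x
    have := hupos x
    positivity
  have hWV : ∀ x, W x ^ (1 - θ) * V x ^ θ = ω₁ x * u x ^ (-(2 * t)) := by
    intro x
    have h1 := hω₁pos x
    have h2 := hω₂pos x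
    have hux := hupos x
    have hW' : W x ^ (1 - θ) = ω₁ x / ω₂ x ^ θ := by
      rw [hWdef, ← Real.rpow_mul (by positivity), h1θ, Real.div_rpow (by positivity) (by positivity),
        ← Real.rpow_mul h1.le, ← Real.rpow_mul h2.le]
      rw [show q * (1 / (p + 1) * ((p + 1) / q)) = 1 by field_simp,
        show 2 * t * (1 / (p + 1) * ((p + 1) / q)) = θ by rw [hθ]; field_simp, Real.rpow_one]
    have hV' : V x ^ θ = ω₂ x ^ θ * u x ^ (-(2 * t)) := by
      rw [hVdef, Real.mul_rpow h2.le (by positivity), ← Real.rpow_mul hux.le]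
      congr 2
      rw [hθ]
      field_simp
    rw [hW', hV']
    have := (Real.rpow_pos_of_pos h2 θ).ne'
    field_simp
  refine ⟨2 * K * (M * c ^ (2 / (1 - θ))), fun R hR => ?_⟩
  have hR0 : 0 < R := one_pos.trans_le hR
  obtain ⟨η, hη, hηc, hη0, hη1, hηone, hηann, hηgrad⟩ := hcut R hR0
  have hφ : ContDiff ℝ 2 fun x => η x ^ n := hη.pow n
  have hφc : HasCompactSupport fun x => η x ^ n :=
    HasCompactSupport.intro hηc fun x hx => by
      simp [image_eq_zero_of_notMem_tsupport hx, hn0]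
  have hest := hen hω₁ hω₂ hω₁pos hu hupos hsup hstab hφ hφc
  have hAint : Integrable fun x => V x * (η x ^ n) ^ 2 :=
    integrable_of_eq_zero_of_notMem (hVc.mul (hφ.continuous.pow 2)) hφc fun x hx => by
      simp [image_eq_zero_of_notMem_tsupport (f := fun x => η x ^ n) hx]
  have hCint : Integrable fun x => ω₁ x * u x ^ (-(2 * t)) * ‖∇ (fun y => η y ^ n) x‖ ^ 2 :=
    integrable_of_eq_zero_of_notMem ((hω₁.continuous.mul
      (hu.continuous.rpow_const fun x => Or.inl (hupos x).ne')).mul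
      ((hφ.gradient (m := 1) (by norm_num)).continuous.norm.pow 2)) hφc fun x hx => by
        simp [gradient_eq_zero_of_notMem_tsupport hx]
  have hWint := (integrableOn_annulus hWc R).integrable_indicator (measurableSet_annulus N R)
  have hpt' : ∀ x, ω₁ x * u x ^ (-(2 * t)) * ‖∇ (fun y => η y ^ n) x‖ ^ 2 ≤
      δ * (V x * (η x ^ n) ^ 2) + M * (c / R) ^ (2 / (1 - θ)) * (annulus N R).indicator W x := by
    intro x
    rw [gradient_pow (hη.differentiable two_ne_zero x), norm_smul, mul_pow, Real.norm_eq_abs,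
      sq_abs, ← mul_assoc]
    by_cases hx : x ∈ annulus N R
    · rw [Set.indicator_of_mem hx, ← hWV]
      have hWx := hWpos x
      have hVx := hVpos x
      refine le_trans ?_ (weighted_young hθ0 hθ1 hδ0 hn' hWx.le hVx.le (hη0 x) (hη1 x)
        (by positivity))
      gcongr
      exact hηgrad x
    · rw [Set.indicator_of_notMem hx, hηann x hx]
      have := hVpos x
      simp
      positivity
  have hI := integral_mono hCint ((hAint.const_mul δ).add (hWint.const_mul _)) hpt'
  simp only [Pi.add_apply] at hI
  rw [integral_add (hAint.const_mul δ) (hWint.const_mul _), integral_const_mul,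
    integral_const_mul, integral_indicator (measurableSet_annulus N R)] at hI
  have hlow : ∫ x in Metric.ball (0 : E) 1, V x ≤ ∫ x, V x * (η x ^ n) ^ 2 := by
    calc ∫ x in Metric.ball (0 : E) 1, V x
        = ∫ x in Metric.ball (0 : E) 1, V x * (η x ^ n) ^ 2 :=
          setIntegral_congr_fun measurableSet_ball fun x hx => by
            simp [hηone x ((mem_ball_zero_iff.1 hx).le.trans hR)]
      _ ≤ _ := setIntegral_le_integral hAint (Eventually.of_forall fun x => by
            have := hVpos x
            positivity)
  have hpow : (c / R) ^ (2 / (1 - θ)) = c ^ (2 / (1 - θ)) * R ^ (-2 * q / (p + 1)) := by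
    rw [Real.div_rpow hc hR0.le, div_eq_mul_inv, ← Real.rpow_neg hR0.le]
    congr 2
    rw [h1θ]
    field_simp
  rw [hpow] at hI
  have h2 := mul_le_mul_of_nonneg_left hI hK.le
  have hKδ : K * δ = 1 / 2 := by
    rw [hδ]
    field_simp
  rw [mul_add, ← mul_assoc K δ, hKδ] at h2
  refine hlow.trans ?_
  have h3 := hest.trans h2
  linarith

end Euclidean

theorem stmt_3 (N : ℕ) (hN : 1 ≤ N) (p : ℝ) (hp : 0 < p)
    (ω₁ ω₂ : EuclideanSpace ℝ (Fin N) → ℝ)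
    (hω₁ : ContDiff ℝ (⊤ : ℕ∞) ω₁) (hω₂ : ContDiff ℝ (⊤ : ℕ∞) ω₂)
    (hω₁pos : ∀ x, 0 < ω₁ x) (hω₂pos : ∀ x, 0 < ω₂ x)
    (t : ℝ) (ht1 : 0 < t) (ht2 : t < p + Real.sqrt (p * (p + 1)))
    (hIM : Tendsto (fun R : ℝ =>
      R ^ (-2*(p + 2*t + 1)/(p + 1)) *
        ∫ x in annulus N R, (ω₁ x ^ (p + 2*t + 1) / ω₂ x ^ (2*t)) ^ (1/(p + 1)))
      atTop (nhds 0))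
    (hJM : Tendsto (fun R : ℝ =>
      R ^ (-(p + 2*t + 1)/(p + 1)) *
        ∫ x in annulus N R, (‖gradient ω₁ x‖ ^ (p + 2*t + 1) / ω₂ x ^ (2*t)) ^ (1/(p + 1)))
      atTop (nhds 0)) :
    ¬ ∃ u : EuclideanSpace ℝ (Fin N) → ℝ, ContDiff ℝ 2 u ∧ (∀ x, 0 < u x) ∧
      (∀ x, -(ω₂ x * u x ^ (-p)) ≤ -vdiv (fun y => ω₁ y • gradient u y) x) ∧
      (∀ ψ : EuclideanSpace ℝ (Fin N) → ℝ, ContDiff ℝ 2 ψ → HasCompactSupport ψ →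
        ∫ x, p * ω₂ x * u x ^ (-p - 1) * ψ x ^ 2 ≤ ∫ x, ω₁ x * ‖gradient ψ x‖ ^ 2) := by
  rintro ⟨u, hu, hupos, hsup, hstab⟩
  have hpt : t ^ 2 < p * (2 * t + 1) := by
    have hs := Real.sq_sqrt (by positivity : 0 ≤ p * (p + 1))
    have hps : p ≤ √(p * (p + 1)) := Real.le_sqrt_of_sq_le (by nlinarith)
    have h1 : |t - p| < √(p * (p + 1)) := abs_lt.2 ⟨by linarith, by linarith⟩
    have h2 := sq_lt_sq' (abs_lt.1 h1).1 (abs_lt.1 h1).2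
    nlinarith
  have hω₁' : ContDiff ℝ 1 ω₁ := hω₁.of_le (by exact_mod_cast le_top)
  obtain ⟨D, hD⟩ := exists_forall_energy_le hp ht1 hpt hω₁' hω₂.continuous hω₁pos hω₂pos hu hupos
    hsup hstab
  have hpos := setIntegral_ball_pos (F := fun x => ω₂ x * u x ^ (-(p + 2 * t + 1)))
    (fun x => mul_pos (hω₂pos x) (Real.rpow_pos_of_pos (hupos x) _))
    (hω₂.continuous.mul (hu.continuous.rpow_const fun x => Or.inl (hupos x).ne'))
  have hlim := hIM.const_mul D
  rw [mul_zero] at hlim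
  exact hpos.not_ge (ge_of_tendsto hlim ((eventually_ge_atTop 1).mono hD))
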